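/- arXiv:2210.05887 — 3 statements merged into one kernel-verified Lean document; each statement's English description precedes it below -/
import Mathlib

section
/- Let X and Y be real Banach spaces, let H be a closed subspace of L(X,Y) such that the rank-one operator x* ⊗ y belongs to H for every x* ∈ X* and y ∈ Y, and let x₀* ∈ S_{X*}, y₀ ∈ S_Y. Then the norm of H is Fréchet differentiable at the operator x₀* ⊗ y₀ if and only if the norm of X* is Fréchet differentiable at x₀* and the norm of Y is Fréchet differentiable at y₀. -/
set_option synthInstance.maxHeartbeats 1000000
set_option maxHeartbeats 1000000

open Metric Set Filter

noncomputable section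

/-- A Banach space `Z` has the **Ball Dentable Property** (`BDP`) if its closed unit ball
has slices of arbitrarily small diameter. -/
def BallDentableProperty (Z : Type*) [NormedAddCommGroup Z] [NormedSpace ℝ Z] : Prop :=
  ∀ ε : ℝ, 0 < ε → ∃ (f : StrongDual ℝ Z) (α : ℝ), ‖f‖ = 1 ∧ 0 < α ∧ α < 1 ∧
    Metric.diam {z : Z | ‖z‖ ≤ 1 ∧ 1 - α < f z} < ε

/-- The dual `Z*` of a Banach space `Z` has the **w*-Ball Dentable Property** (`w*-BDP`) if the
closed unit ball of `Z*` has weak-star slices (slices given by elements of the predual `Z`)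
of arbitrarily small diameter. -/
def WStarBallDentableProperty (Z : Type*) [NormedAddCommGroup Z] [NormedSpace ℝ Z] : Prop :=
  ∀ ε : ℝ, 0 < ε → ∃ (z : Z) (α : ℝ), ‖z‖ = 1 ∧ 0 < α ∧ α < 1 ∧
    Metric.diam {f : StrongDual ℝ Z | ‖f‖ ≤ 1 ∧ 1 - α < f z} < ε

/-- A Banach space `Z` has the **Ball Small Combination of Slices Property** (`BSCSP`) if its
closed unit ball has convex combinations of slices of arbitrarily small diameter. -/
def BallSCSProperty (Z : Type*) [NormedAddCommGroup Z] [NormedSpace ℝ Z] : Prop :=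
  ∀ ε : ℝ, 0 < ε → ∃ (n : ℕ) (lam : Fin (n + 1) → ℝ) (f : Fin (n + 1) → StrongDual ℝ Z)
    (α : Fin (n + 1) → ℝ),
    (∀ i, 0 < lam i) ∧ (∑ i, lam i = 1) ∧ (∀ i, ‖f i‖ = 1) ∧ (∀ i, 0 < α i ∧ α i < 1) ∧
    Metric.diam {z : Z | ∃ g : Fin (n + 1) → Z,
      (∀ i, ‖g i‖ ≤ 1 ∧ 1 - α i < f i (g i)) ∧ z = ∑ i, lam i • g i} < ε

/-- The dual `Z*` of a Banach space `Z` has the **w*-Ball Small Combination of Slices Property**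
(`w*-BSCSP`) if the closed unit ball of `Z*` has convex combinations of weak-star slices
(slices given by elements of the predual `Z`) of arbitrarily small diameter. -/
def WStarBallSCSProperty (Z : Type*) [NormedAddCommGroup Z] [NormedSpace ℝ Z] : Prop :=
  ∀ ε : ℝ, 0 < ε → ∃ (n : ℕ) (lam : Fin (n + 1) → ℝ) (z : Fin (n + 1) → Z)
    (α : Fin (n + 1) → ℝ),
    (∀ i, 0 < lam i) ∧ (∑ i, lam i = 1) ∧ (∀ i, ‖z i‖ = 1) ∧ (∀ i, 0 < α i ∧ α i < 1) ∧
    Metric.diam {φ : StrongDual ℝ Z | ∃ g : Fin (n + 1) → StrongDual ℝ Z,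
      (∀ i, ‖g i‖ ≤ 1 ∧ 1 - α i < g i (z i)) ∧ φ = ∑ i, lam i • g i} < ε

/-- The roughness `η(Z, u)` of the norm of `Z` at `u`:
`limsup_{‖h‖ → 0} (‖u + h‖ + ‖u - h‖ - 2) / ‖h‖`. -/
noncomputable def roughness (Z : Type*) [NormedAddCommGroup Z] (u : Z) : ℝ :=
  Filter.limsup (fun h : Z => (‖u + h‖ + ‖u - h‖ - 2) / ‖h‖) (nhdsWithin 0 {(0 : Z)}ᶜ)

/-- The norm of `Z` is **rough** if it is `ε`-rough for some `ε > 0`, i.e. there is `ε > 0`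
with `η(Z, u) ≥ ε` for every `u` in the unit sphere of `Z`. -/
def RoughNorm (Z : Type*) [NormedAddCommGroup Z] : Prop :=
  ∃ ε : ℝ, 0 < ε ∧ ∀ u : Z, ‖u‖ = 1 → ε ≤ roughness Z u

/-- The norm of `Z` is **non-rough** if it is not rough. -/
def NonRoughNorm (Z : Type*) [NormedAddCommGroup Z] : Prop := ¬ RoughNorm Z

/-- The rank-one operator `x* ⊗ y : E → F`, `x ↦ x*(x) • y`. -/
noncomputable def rankOneOp {E F : Type*} [NormedAddCommGroup E] [NormedSpace ℝ E]
    [NormedAddCommGroup F] [NormedSpace ℝ F] (f : StrongDual ℝ E) (y : F) : E →L[ℝ] F :=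
  f.smulRight y

/-- For a subspace `H ⊆ L(E, F)`, a vector `x ∈ E` and a functional `g ∈ F*`, the functional
`x ⊗ g ∈ H*` given by `T ↦ g (T x)`. -/
noncomputable def dualTensorFunctional {E F : Type*} [NormedAddCommGroup E] [NormedSpace ℝ E]
    [NormedAddCommGroup F] [NormedSpace ℝ F] (H : Submodule ℝ (E →L[ℝ] F)) (x : E)
    (g : StrongDual ℝ F) : StrongDual ℝ H :=
  g.comp ((ContinuousLinearMap.apply ℝ F x).comp H.subtypeL)

/-- The weak-star closed convex hull of a subset `S` of the dual `Z*`. -/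
noncomputable def wStarClosedConvexHull (Z : Type*) [NormedAddCommGroup Z] [NormedSpace ℝ Z]
    (S : Set (StrongDual ℝ Z)) : Set (StrongDual ℝ Z) :=
  StrongDual.toWeakDual ⁻¹'
    closure (convexHull ℝ (StrongDual.toWeakDual '' S))

/-- `D(Z, u)`: the set of norm-at-most-one functionals attaining the value `1` at `u`. -/
def dualFace (Z : Type*) [NormedAddCommGroup Z] [NormedSpace ℝ Z] (u : Z) :
    Set (StrongDual ℝ Z) := {h | ‖h‖ ≤ 1 ∧ h u = 1}

/-- `n(Z, u)`: the largest non-negative `k` such that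
`k * ‖z‖ ≤ sup {|f z| : f ∈ D(Z, u)}` for every `z ∈ Z`. -/
noncomputable def nConstant (Z : Type*) [NormedAddCommGroup Z] [NormedSpace ℝ Z] (u : Z) : ℝ :=
  sSup {k : ℝ | 0 ≤ k ∧ ∀ z : Z, k * ‖z‖ ≤ ⨆ f : dualFace Z u, |f.1 z|}

/-- The Banach space `B(X × Y)` of bounded bilinear forms on `X × Y`, realized as
`X →L[ℝ] Y →L[ℝ] ℝ`. -/
def BoundedBilinearForms (X Y : Type*) [NormedAddCommGroup X] [NormedSpace ℝ X]
    [NormedAddCommGroup Y] [NormedSpace ℝ Y] : Type _ :=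
  X →L[ℝ] Y →L[ℝ] ℝ

noncomputable instance {X Y : Type*} [NormedAddCommGroup X] [NormedSpace ℝ X]
    [NormedAddCommGroup Y] [NormedSpace ℝ Y] : NormedAddCommGroup (BoundedBilinearForms X Y) :=
  inferInstanceAs (NormedAddCommGroup (X →L[ℝ] Y →L[ℝ] ℝ))

noncomputable instance {X Y : Type*} [NormedAddCommGroup X] [NormedSpace ℝ X]
    [NormedAddCommGroup Y] [NormedSpace ℝ Y] : NormedSpace ℝ (BoundedBilinearForms X Y) :=
  inferInstanceAs (NormedSpace ℝ (X →L[ℝ] Y →L[ℝ] ℝ))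

/-- The canonical image of the elementary tensor `x ⊗ y` in the dual of the space of bounded
bilinear forms on `X × Y`; it acts by `B ↦ B x y`. -/
noncomputable def projTensorElem {X Y : Type*} [NormedAddCommGroup X] [NormedSpace ℝ X]
    [NormedAddCommGroup Y] [NormedSpace ℝ Y] (x : X) (y : Y) :
    StrongDual ℝ (BoundedBilinearForms X Y) :=
  (ContinuousLinearMap.apply ℝ ℝ y).comp (ContinuousLinearMap.apply ℝ (Y →L[ℝ] ℝ) x)

/-- The projective tensor product `X ⊗̂_π Y`, realized canonically (and isometrically) as the
closure of the span of the elementary tensors inside the dual of the Banach space of bounded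
bilinear forms on `X × Y`.  (On elementary tensor combinations the dual norm coincides with the
projective norm, so this closed subspace is the canonical isometric copy of the completion
`X ⊗̂_π Y`.) -/
noncomputable def ProjectiveTensorProduct (X Y : Type*) [NormedAddCommGroup X] [NormedSpace ℝ X]
    [NormedAddCommGroup Y] [NormedSpace ℝ Y] :
    Submodule ℝ (StrongDual ℝ (BoundedBilinearForms X Y)) :=
  (Submodule.span ℝ {φ | ∃ x y, φ = projTensorElem x y}).topologicalClosure

/-- The projective tensor product `X ⊗̂_π Y` as a Banach space. -/
def ProjectiveTensorSpace (X Y : Type*) [NormedAddCommGroup X] [NormedSpace ℝ X]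
    [NormedAddCommGroup Y] [NormedSpace ℝ Y] : Type _ :=
  ↥(ProjectiveTensorProduct X Y)

noncomputable instance {X Y : Type*} [NormedAddCommGroup X] [NormedSpace ℝ X]
    [NormedAddCommGroup Y] [NormedSpace ℝ Y] : NormedAddCommGroup (ProjectiveTensorSpace X Y) :=
  inferInstanceAs (NormedAddCommGroup ↥(ProjectiveTensorProduct X Y))

noncomputable instance {X Y : Type*} [NormedAddCommGroup X] [NormedSpace ℝ X]
    [NormedAddCommGroup Y] [NormedSpace ℝ Y] : NormedSpace ℝ (ProjectiveTensorSpace X Y) :=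
  inferInstanceAs (NormedSpace ℝ ↥(ProjectiveTensorProduct X Y))

/-- The rank-one operator `x ⊗ y : X* → Y`, `x* ↦ x*(x) • y`. -/
noncomputable def injTensorElem {X Y : Type*} [NormedAddCommGroup X] [NormedSpace ℝ X]
    [NormedAddCommGroup Y] [NormedSpace ℝ Y] (x : X) (y : Y) :
    StrongDual ℝ X →L[ℝ] Y :=
  (ContinuousLinearMap.apply ℝ ℝ x).smulRight y

set_option maxSynthPendingDepth 3 in
/-- The injective tensor product `X ⊗̂_ε Y`, realized canonically (and isometrically) as the
closure of the span of the rank-one operators `x ⊗ y` inside the Banach space `L(X*, Y)`.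
(On elementary tensor combinations the operator norm coincides with the injective norm, so this
closed subspace is the canonical isometric copy of the completion `X ⊗̂_ε Y`.) -/
noncomputable def InjectiveTensorProduct (X Y : Type*) [NormedAddCommGroup X] [NormedSpace ℝ X]
    [NormedAddCommGroup Y] [NormedSpace ℝ Y] :
    Submodule ℝ (StrongDual ℝ X →L[ℝ] Y) :=
  (Submodule.span ℝ {T | ∃ x y, T = injTensorElem x y}).topologicalClosure

/-- The injective tensor product `X ⊗̂_ε Y` as a Banach space. -/
def InjectiveTensorSpace (X Y : Type*) [NormedAddCommGroup X] [NormedSpace ℝ X]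
    [NormedAddCommGroup Y] [NormedSpace ℝ Y] : Type _ :=
  ↥(InjectiveTensorProduct X Y)

set_option maxSynthPendingDepth 3 in
noncomputable instance {X Y : Type*} [NormedAddCommGroup X] [NormedSpace ℝ X]
    [NormedAddCommGroup Y] [NormedSpace ℝ Y] : NormedAddCommGroup (InjectiveTensorSpace X Y) :=
  inferInstanceAs (NormedAddCommGroup ↥(InjectiveTensorProduct X Y))

set_option maxSynthPendingDepth 3 in
noncomputable instance {X Y : Type*} [NormedAddCommGroup X] [NormedSpace ℝ X]
    [NormedAddCommGroup Y] [NormedSpace ℝ Y] : NormedSpace ℝ (InjectiveTensorSpace X Y) :=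
  inferInstanceAs (NormedSpace ℝ ↥(InjectiveTensorProduct X Y))

end


/-- Norm of a rank-one operator, pointwise epsilon form of Frechet differentiability. -/
lemma norm_diff_eps {Z : Type*} [NormedAddCommGroup Z] [NormedSpace ℝ Z] {z : Z}
    (h : DifferentiableAt ℝ (fun w : Z => ‖w‖) z) {c : ℝ} (hc : 0 < c) :
    ∃ δ > 0, ∀ w : Z, ‖w‖ < δ →
      ‖z + w‖ ≤ ‖z‖ + fderiv ℝ (fun w : Z => ‖w‖) z w + c * ‖w‖ := by
  have h1 := hasFDerivAt_iff_isLittleO_nhds_zero.1 h.hasFDerivAt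
  have h2 := Asymptotics.isLittleO_iff.1 h1 hc
  obtain ⟨δ, hδ, H⟩ := Metric.eventually_nhds_iff.1 h2
  refine ⟨δ, hδ, fun w hw => ?_⟩
  have h3 := H (y := w) (by simpa using hw)
  rw [Real.norm_eq_abs] at h3
  have := (abs_le.1 h3).2
  linarith

lemma fderiv_norm_le {Z : Type*} [NormedAddCommGroup Z] [NormedSpace ℝ Z] (z : Z) :
    ‖fderiv ℝ (fun w : Z => ‖w‖) z‖ ≤ 1 := by
  simpa using norm_fderiv_le_of_lipschitz ℝ (lipschitzWith_one_norm (E := Z)) (x₀ := z)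

lemma dual_le {Z : Type*} [NormedAddCommGroup Z] [NormedSpace ℝ Z] {g : StrongDual ℝ Z}
    (hg : ‖g‖ ≤ 1) (z : Z) : |g z| ≤ ‖z‖ := by
  have := g.le_of_opNorm_le hg z
  simpa using this

lemma norm_diff_of_isometry {E F : Type*} [NormedAddCommGroup E] [NormedSpace ℝ E]
    [NormedAddCommGroup F] [NormedSpace ℝ F] (J : E → F) (hadd : ∀ a b, J (a + b) = J a + J b)
    (hsmul : ∀ (c : ℝ) a, J (c • a) = c • J a) (hnorm : ∀ a, ‖J a‖ = ‖a‖) (e : E)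
    (h : DifferentiableAt ℝ (fun w : F => ‖w‖) (J e)) :
    DifferentiableAt ℝ (fun w : E => ‖w‖) e := by
  let J' : E →ₗᵢ[ℝ] F := ⟨⟨⟨J, hadd⟩, hsmul⟩, hnorm⟩
  have hJ : DifferentiableAt ℝ J e :=
    J'.toContinuousLinearMap.differentiableAt
  have h2 : DifferentiableAt ℝ (fun w : E => ‖J w‖) e :=
    DifferentiableAt.comp (g := fun w : F => ‖w‖) e h hJ
  simpa [hnorm] using h2

lemma rankOne_diff {X Y : Type*} [NormedAddCommGroup X] [NormedSpace ℝ X]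
    [NormedAddCommGroup Y] [NormedSpace ℝ Y]
    (x₀s : StrongDual ℝ X) (hx₀s : ‖x₀s‖ = 1) (y₀ : Y) (hy₀ : ‖y₀‖ = 1)
    (h1 : DifferentiableAt ℝ (fun f : StrongDual ℝ X => ‖f‖) x₀s)
    (h2 : DifferentiableAt ℝ (fun y : Y => ‖y‖) y₀) :
    DifferentiableAt ℝ (fun T : X →L[ℝ] Y => ‖T‖) (rankOneOp x₀s y₀) := by
  set φ := fderiv ℝ (fun f : StrongDual ℝ X => ‖f‖) x₀s with hφ
  set g : StrongDual ℝ Y := fderiv ℝ (fun y : Y => ‖y‖) y₀ with hg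
  have hφ1 : ‖φ‖ ≤ 1 := fderiv_norm_le _
  have hg1 : ‖g‖ ≤ 1 := fderiv_norm_le _
  have hφ0 : φ x₀s = 1 := by rw [hφ, h1.fderiv_norm_self, hx₀s]
  have hg0 : g y₀ = 1 := by rw [hg, h2.fderiv_norm_self, hy₀]
  let D : StrongDual ℝ (X →L[ℝ] Y) := φ.comp (ContinuousLinearMap.compL ℝ X Y ℝ g)
  have hgT : ∀ T : X →L[ℝ] Y, ‖g.comp T‖ ≤ ‖T‖ := fun T => by
    refine (g.opNorm_comp_le T).trans ?_
    nlinarith [norm_nonneg T]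
  have hDv : ∀ T : X →L[ℝ] Y, D T = φ (g.comp T) := fun T => rfl
  have hDle : ∀ T : X →L[ℝ] Y, |D T| ≤ ‖T‖ := fun T =>
    (dual_le hφ1 _).trans (hgT T)
  have hA : g.comp (rankOneOp x₀s y₀) = x₀s := by
    ext x
    simp [rankOneOp, hg0]
  have hDA : D (rankOneOp x₀s y₀) = 1 := by rw [hDv, hA, hφ0]
  have hnA : ‖rankOneOp x₀s y₀‖ = 1 := by
    simp [rankOneOp, ContinuousLinearMap.norm_smulRight_apply, hx₀s, hy₀]
  refine HasFDerivAt.differentiableAt (f' := D) ?_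
  rw [hasFDerivAt_iff_isLittleO_nhds_zero, Asymptotics.isLittleO_iff]
  intro c hc
  obtain ⟨δ1, hδ1, H1⟩ := norm_diff_eps h1 (half_pos hc)
  obtain ⟨δ2, hδ2, H2⟩ := norm_diff_eps h2 (half_pos hc)
  rw [Metric.eventually_nhds_iff]
  refine ⟨min δ1 (min (δ2 / 2) (1 / 4)), by positivity, fun T hT => ?_⟩
  rw [dist_zero_right, lt_min_iff, lt_min_iff] at hT
  obtain ⟨hT1, hT2, hT3⟩ := hT
  have hlow : 1 + D T ≤ ‖rankOneOp x₀s y₀ + T‖ := by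
    have := (abs_le.1 (hDle (rankOneOp x₀s y₀ + T))).2
    rwa [map_add, hDA] at this
  have hT0 := norm_nonneg T
  have hDT := abs_le.1 (hDle T)
  have hcT : 0 ≤ c * ‖T‖ := by positivity
  -- the key estimate
  have key : ∀ x : X, ‖x‖ ≤ 1 → 0 ≤ x₀s x →
      ‖(rankOneOp x₀s y₀ + T) x‖ ≤ 1 + D T + c * ‖T‖ := by
    intro x hx ht
    have hTx : ‖T x‖ ≤ ‖T‖ := T.unit_le_opNorm x hx
    have hval : (rankOneOp x₀s y₀ + T) x = x₀s x • y₀ + T x := rfl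
    rw [hval]
    rcases lt_or_ge (x₀s x) (1 / 2) with hlt | hge
    · have : ‖x₀s x • y₀ + T x‖ ≤ x₀s x + ‖T x‖ := by
        refine (norm_add_le _ _).trans ?_
        rw [norm_smul, hy₀, mul_one, Real.norm_eq_abs, abs_of_nonneg ht]
      linarith [hDT.1]
    · set t := x₀s x with htdef
      have htp : 0 < t := by linarith
      have e1 : t • y₀ + T x = t • (y₀ + t⁻¹ • T x) := by
        rw [smul_add, smul_smul, mul_inv_cancel₀ htp.ne', one_smul]
      have hnorm : ‖t⁻¹ • T x‖ = t⁻¹ * ‖T x‖ := by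
        rw [norm_smul, Real.norm_eq_abs, abs_of_pos (inv_pos.2 htp)]
      have hti : t⁻¹ ≤ 2 := by
        rw [inv_le_comm₀ htp (by norm_num)]; linarith
      have hsm : ‖t⁻¹ • T x‖ < δ2 := by
        rw [hnorm]
        nlinarith [norm_nonneg (T x)]
      have b1 := H2 _ hsm
      rw [hnorm, hy₀, ← hg, map_smul, smul_eq_mul] at b1
      have b2 : ‖t • y₀ + T x‖ ≤ t + g (T x) + c / 2 * ‖T x‖ := by
        rw [e1, norm_smul, Real.norm_eq_abs, abs_of_pos htp]
        refine (mul_le_mul_of_nonneg_left b1 htp.le).trans (le_of_eq ?_)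
        field_simp
      have b3 := H1 (g.comp T) ((hgT T).trans_lt hT1)
      rw [hx₀s, ← hφ, ← hDv] at b3
      have b4 : t + g (T x) ≤ ‖x₀s + g.comp T‖ :=
        (le_abs_self _).trans ((x₀s + g.comp T).unit_le_opNorm x hx)
      have b5 := mul_le_mul_of_nonneg_left hTx (half_pos hc).le
      have b6 := mul_le_mul_of_nonneg_left (hgT T) (half_pos hc).le
      linarith
  have hup : ‖rankOneOp x₀s y₀ + T‖ ≤ 1 + D T + c * ‖T‖ := by
    refine ContinuousLinearMap.opNorm_le_of_unit_norm (by linarith [hDT.1]) fun x hx => ?_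
    rcases le_total 0 (x₀s x) with h | h
    · exact key x hx.le h
    · have := key (-x) (by rw [norm_neg, hx]) (by rw [map_neg]; linarith)
      rwa [map_neg, norm_neg] at this
  rw [hnA, Real.norm_eq_abs, abs_le]
  constructor <;> linarith

/-- Corollary 2.10: if `H` is a closed subspace of `L(X, Y)` with `X* ⊗ Y ⊆ H`
and `x₀* ∈ S_{X*}`, `y₀ ∈ S_Y`, then the norm of `H` is Fréchet differentiable at `x₀* ⊗ y₀` iff
the norms of `X*` and `Y` are Fréchet differentiable at `x₀*` and `y₀` respectively. -/
theorem statement6 {X Y : Type*} [NormedAddCommGroup X] [NormedSpace ℝ X] [CompleteSpace X]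
    [NormedAddCommGroup Y] [NormedSpace ℝ Y] [CompleteSpace Y]
    (H : Submodule ℝ (X →L[ℝ] Y)) (hH : IsClosed (H : Set (X →L[ℝ] Y)))
    (hmem : ∀ (f : StrongDual ℝ X) (y : Y), rankOneOp f y ∈ H)
    (x₀s : StrongDual ℝ X) (hx₀s : ‖x₀s‖ = 1) (y₀ : Y) (hy₀ : ‖y₀‖ = 1) :
    DifferentiableAt ℝ (fun T : H => ‖T‖) (⟨rankOneOp x₀s y₀, hmem x₀s y₀⟩ : H) ↔
      DifferentiableAt ℝ (fun f : StrongDual ℝ X => ‖f‖) x₀s ∧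
        DifferentiableAt ℝ (fun y : Y => ‖y‖) y₀ := by
  constructor
  · intro h
    constructor
    · refine norm_diff_of_isometry (F := H) (fun f => ⟨rankOneOp f y₀, hmem f y₀⟩)
        (fun f f' => ?_) (fun a f => ?_) (fun f => ?_) x₀s h
      · ext x; simp [rankOneOp, add_smul]
      · ext x; simp [rankOneOp, mul_smul]
      · change ‖rankOneOp f y₀‖ = ‖f‖
        simp [rankOneOp, ContinuousLinearMap.norm_smulRight_apply, hy₀]
    · refine norm_diff_of_isometry (F := H) (fun y => ⟨rankOneOp x₀s y, hmem x₀s y⟩)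
        (fun f f' => ?_) (fun a f => ?_) (fun f => ?_) y₀ h
      · ext x; simp [rankOneOp]
      · ext x; simp [rankOneOp, smul_comm a (x₀s x)]
      · change ‖rankOneOp x₀s f‖ = ‖f‖
        simp [rankOneOp, ContinuousLinearMap.norm_smulRight_apply, hx₀s]
  · rintro ⟨h1, h2⟩
    have h := rankOne_diff x₀s hx₀s y₀ hy₀ h1 h2
    exact norm_diff_of_isometry (E := H) (F := X →L[ℝ] Y) (fun T => T.1)
      (fun _ _ => rfl) (fun _ _ => rfl) (fun _ => rfl) ⟨rankOneOp x₀s y₀, hmem x₀s y₀⟩ h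
end

section
/- Let X and Y be real Banach spaces such that there exists f ∈ S_{X*} with n(X*, f) = 1, and let H be a closed subspace of L(X,Y) such that the rank-one operator x* ⊗ y belongs to H for every x* ∈ X* and y ∈ Y. If H* has the w*-Ball Small Combination of Slices Property, then Y* has the w*-Ball Small Combination of Slices Property. -/
set_option synthInstance.maxHeartbeats 1000000
set_option maxHeartbeats 1000000

open Metric Set Filter

/-- Under `n(X*, f) = 1`, every norm-one operator almost attains its norm at a point of the ball
where `f` is almost `1`. -/
lemma exists_good_point {X Y : Type*} [NormedAddCommGroup X] [NormedSpace ℝ X]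
    [NormedAddCommGroup Y] [NormedSpace ℝ Y]
    (f : StrongDual ℝ X) (hf : ‖f‖ = 1) (hnf : nConstant (StrongDual ℝ X) f = 1)
    (T : X →L[ℝ] Y) (hT : ‖T‖ = 1) (α δ : ℝ) (hα : 0 < α) (hα1 : α < 1) (hδ : 0 < δ) :
    ∃ x : X, ‖x‖ ≤ 1 ∧ 1 - δ < f x ∧ 1 - α < ‖T x‖ := by
  obtain ⟨x0, hx0, hTx0⟩ := T.exists_lt_apply_of_lt_opNorm (r := 1 - α) (by linarith)
  obtain ⟨g, hg1, hg2⟩ := exists_dual_vector'' ℝ (T x0)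
  set φ : StrongDual ℝ X := g.comp T with hφ
  have hφ1 : ‖φ‖ ≤ 1 := by
    calc ‖φ‖ ≤ ‖g‖ * ‖T‖ := g.opNorm_comp_le T
      _ ≤ 1 := by rw [hT, mul_one]; exact hg1
  have hφ2 : 1 - α < ‖φ‖ := by
    have h1 : φ x0 = ‖T x0‖ := by simpa [hφ] using hg2
    have h2 : φ x0 ≤ ‖φ‖ * ‖x0‖ := (le_abs_self _).trans (φ.le_opNorm x0)
    have h3 : ‖φ‖ * ‖x0‖ ≤ ‖φ‖ := mul_le_of_le_one_right (norm_nonneg _) hx0.le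
    linarith
  have hφ0 : 0 < ‖φ‖ := by linarith
  have hne : {k : ℝ | 0 ≤ k ∧ ∀ z : StrongDual ℝ X,
      k * ‖z‖ ≤ ⨆ f : dualFace (StrongDual ℝ X) f, |f.1 z|}.Nonempty := by
    by_contra hcon
    rw [Set.not_nonempty_iff_eq_empty] at hcon
    unfold nConstant at hnf
    rw [hcon] at hnf
    simp at hnf
  have hlt : (1 - α) / ‖φ‖ < nConstant (StrongDual ℝ X) f := by
    rw [hnf, div_lt_one hφ0]; exact hφ2
  obtain ⟨k, ⟨hk0, hk⟩, hk2⟩ := exists_lt_of_lt_csSup hne hlt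
  have hk3 : 1 - α < ⨆ f : dualFace (StrongDual ℝ X) f, |f.1 φ| := by
    rw [div_lt_iff₀ hφ0] at hk2
    exact hk2.trans_le (hk φ)
  have hne2 : Nonempty (dualFace (StrongDual ℝ X) f) := by
    by_contra hcon
    rw [not_nonempty_iff] at hcon
    rw [Real.iSup_of_isEmpty] at hk3
    linarith
  obtain ⟨⟨h, hh1, hh2⟩, hh3⟩ := exists_lt_of_lt_ciSup hk3
  simp only at hh3
  -- choose the sign
  obtain ⟨ψ, hψ1, hψ2, hψ3⟩ : ∃ ψ : StrongDual ℝ X, ‖ψ‖ ≤ 1 ∧ 1 - α < h ψ ∧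
      ∀ x, |ψ x| = |φ x| := by
    rcases lt_abs.1 hh3 with h1 | h1
    · exact ⟨φ, hφ1, h1, fun _ => rfl⟩
    · exact ⟨-φ, by rwa [norm_neg], by rwa [map_neg], fun x => by simp⟩
  obtain ⟨M, hM0, hM⟩ : ∃ M : ℝ, 0 < M ∧ 1 ≤ M * δ :=
    ⟨1 / δ, by positivity, by field_simp; exact le_rfl⟩
  have hnorm : M + (1 - α) < ‖M • f + ψ‖ := by
    have h1 : h (M • f + ψ) ≤ ‖h‖ * ‖M • f + ψ‖ := (le_abs_self _).trans (h.le_opNorm _)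
    have h2 : ‖h‖ * ‖M • f + ψ‖ ≤ ‖M • f + ψ‖ :=
      mul_le_of_le_one_left (norm_nonneg _) hh1
    have h3 : h (M • f + ψ) = M + h ψ := by
      rw [map_add, map_smul, hh2]; simp
    linarith
  obtain ⟨x1, hx1, hx1'⟩ := (M • f + ψ).exists_lt_apply_of_lt_opNorm hnorm
  obtain ⟨x, hx, hx'⟩ : ∃ x : X, ‖x‖ ≤ 1 ∧ M + (1 - α) < M * f x + ψ x := by
    rw [Real.norm_eq_abs] at hx1'
    rcases lt_abs.1 hx1' with h1 | h1
    · exact ⟨x1, hx1.le, by simpa using h1⟩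
    · refine ⟨-x1, by rw [norm_neg]; exact hx1.le, ?_⟩
      have : (M • f + ψ) x1 = M * f x1 + ψ x1 := by simp
      rw [this] at h1
      rw [map_neg, map_neg]; linarith
  have hfx : f x ≤ 1 := by
    have := (le_abs_self _).trans (f.le_opNorm x)
    rw [hf, one_mul] at this
    linarith
  have hψx : ψ x ≤ 1 := by
    have h1 := (le_abs_self _).trans (ψ.le_opNorm x)
    have := mul_le_one₀ hψ1 (norm_nonneg x) hx
    linarith
  refine ⟨x, hx, ?_, ?_⟩
  · by_contra hcon
    push Not at hcon
    have := mul_le_mul_of_nonneg_left hcon hM0.le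
    nlinarith
  · have h1 : 1 - α < ψ x := by nlinarith
    have h2 : |φ x| ≤ ‖T x‖ := by
      have := g.le_opNorm (T x)
      have h4 := mul_le_of_le_one_left (norm_nonneg (T x)) hg1
      exact this.trans h4
    have h3 := le_abs_self (ψ x)
    rw [hψ3] at h3
    linarith

set_option maxSynthPendingDepth 3 in
/-- Proposition 2.16: if there is `f ∈ S_{X*}` with `n(X*, f) = 1` and `H` is a
closed subspace of `L(X, Y)` with `X* ⊗ Y ⊆ H` whose dual `H*` has the `w*`-BSCSP, then `Y*`
has the `w*`-BSCSP. -/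
theorem statement11 {X Y : Type*} [NormedAddCommGroup X] [NormedSpace ℝ X] [CompleteSpace X]
    [NormedAddCommGroup Y] [NormedSpace ℝ Y] [CompleteSpace Y]
    (f : StrongDual ℝ X) (hf : ‖f‖ = 1) (hnf : nConstant (StrongDual ℝ X) f = 1)
    (H : Submodule ℝ (X →L[ℝ] Y)) (hH : IsClosed (H : Set (X →L[ℝ] Y)))
    (hmem : ∀ (g : StrongDual ℝ X) (y : Y), rankOneOp g y ∈ H)
    (hHs : WStarBallSCSProperty H) :
    WStarBallSCSProperty Y := by
  intro ε hε
  obtain ⟨n, lam, T, α, hlam, hsum, hT, hα, hdiam⟩ := hHs (ε / 4) (by positivity)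
  have hpt : ∀ i, ∃ x : X, ‖x‖ ≤ 1 ∧ 1 - ε / 4 < f x ∧ 1 - α i < ‖(T i : X →L[ℝ] Y) x‖ :=
    fun i => exists_good_point f hf hnf (T i : X →L[ℝ] Y) (hT i) (α i) (ε / 4)
      (hα i).1 (hα i).2 (by positivity)
  choose x hx hfx hTx using hpt
  have hpos : ∀ i, 0 < ‖(T i : X →L[ℝ] Y) (x i)‖ := fun i => by
    linarith [hTx i, (hα i).2]
  refine ⟨n, lam, fun i => ‖(T i : X →L[ℝ] Y) (x i)‖⁻¹ • (T i : X →L[ℝ] Y) (x i),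
    fun i => 1 - (1 - α i) / ‖(T i : X →L[ℝ] Y) (x i)‖, hlam, hsum, ?_, ?_, ?_⟩
  · intro i
    rw [norm_smul, norm_inv, norm_norm, inv_mul_cancel₀ (hpos i).ne']
  · intro i
    have h1 : (1 - α i) / ‖(T i : X →L[ℝ] Y) (x i)‖ < 1 := (div_lt_one (hpos i)).2 (hTx i)
    have h2 : 0 < (1 - α i) / ‖(T i : X →L[ℝ] Y) (x i)‖ :=
      div_pos (by linarith [(hα i).2]) (hpos i)
    constructor <;> linarith
  set S : Set (StrongDual ℝ H) := {φ | ∃ g : Fin (n + 1) → StrongDual ℝ H,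
      (∀ i, ‖g i‖ ≤ 1 ∧ 1 - α i < g i (T i)) ∧ φ = ∑ i, lam i • g i} with hS
  have hSb : Bornology.IsBounded S := by
    refine (isBounded_iff_forall_norm_le).2 ⟨1, ?_⟩
    rintro φ ⟨g, hg, rfl⟩
    calc ‖∑ i, lam i • g i‖ ≤ ∑ i, ‖lam i • g i‖ := norm_sum_le _ _
      _ ≤ ∑ i, lam i := by
        refine Finset.sum_le_sum fun i _ => ?_
        rw [norm_smul, Real.norm_of_nonneg (hlam i).le]
        exact mul_le_of_le_one_right (hlam i).le (hg i).1
      _ = 1 := hsum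
  have hin : ∀ g : Fin (n + 1) → StrongDual ℝ Y,
      (∀ i, ‖g i‖ ≤ 1 ∧ 1 - (1 - (1 - α i) / ‖(T i : X →L[ℝ] Y) (x i)‖) <
        g i (‖(T i : X →L[ℝ] Y) (x i)‖⁻¹ • (T i : X →L[ℝ] Y) (x i))) →
      (∑ i, lam i • dualTensorFunctional H (x i) (g i)) ∈ S := by
    intro g hg
    refine ⟨fun i => dualTensorFunctional H (x i) (g i), fun i => ⟨?_, ?_⟩, rfl⟩
    · refine ContinuousLinearMap.opNorm_le_bound _ zero_le_one fun A => ?_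
      change ‖g i ((A : X →L[ℝ] Y) (x i))‖ ≤ 1 * ‖(A : X →L[ℝ] Y)‖
      have h1 := (g i).le_opNorm ((A : X →L[ℝ] Y) (x i))
      have h2 := mul_le_of_le_one_left (norm_nonneg ((A : X →L[ℝ] Y) (x i))) (hg i).1
      have h3 := (A : X →L[ℝ] Y).le_opNorm (x i)
      have h4 := mul_le_of_le_one_right (norm_nonneg (A : X →L[ℝ] Y)) (hx i)
      linarith
    · change 1 - α i < g i ((T i : X →L[ℝ] Y) (x i))
      have h1 := (hg i).2
      rw [map_smul, smul_eq_mul, sub_sub_cancel, div_eq_inv_mul] at h1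
      exact lt_of_mul_lt_mul_left h1 (inv_nonneg.2 (hpos i).le)
  refine lt_of_le_of_lt (b := 3 * ε / 4) ?_ (by linarith)
  refine Metric.diam_le_of_forall_dist_le (by positivity) ?_
  rintro _ ⟨g, hg, rfl⟩ _ ⟨g', hg', rfl⟩
  have hd := (Metric.dist_le_diam_of_mem hSb (hin g hg) (hin g' hg')).trans hdiam.le
  rw [dist_eq_norm] at hd ⊢
  refine ContinuousLinearMap.opNorm_le_bound _ (by positivity) fun y => ?_
  have key := ContinuousLinearMap.le_of_opNorm_le _ hd (⟨rankOneOp f y, hmem f y⟩ : H)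
  have hny : ‖(⟨rankOneOp f y, hmem f y⟩ : H)‖ = ‖y‖ := by
    change ‖f.smulRight y‖ = ‖y‖
    rw [ContinuousLinearMap.norm_smulRight_apply, hf, one_mul]
  rw [hny] at key
  have e1 : ((∑ i, lam i • dualTensorFunctional H (x i) (g i)) -
      ∑ i, lam i • dualTensorFunctional H (x i) (g' i)) (⟨rankOneOp f y, hmem f y⟩ : H)
      = ∑ i, lam i * (f (x i) * (g i y - g' i y)) := by
    rw [← Finset.sum_sub_distrib, ContinuousLinearMap.sum_apply]
    refine Finset.sum_congr rfl fun i _ => ?_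
    change lam i * g i (f (x i) • y) - lam i * g' i (f (x i) • y) = _
    rw [map_smul, map_smul, smul_eq_mul, smul_eq_mul]; ring
  have e2 : ((∑ i, lam i • g i) - ∑ i, lam i • g' i) y
      = ∑ i, lam i * (f (x i) * (g i y - g' i y))
        + ∑ i, lam i * ((1 - f (x i)) * (g i y - g' i y)) := by
    rw [← Finset.sum_sub_distrib, ContinuousLinearMap.sum_apply, ← Finset.sum_add_distrib]
    refine Finset.sum_congr rfl fun i _ => ?_
    change lam i * g i y - lam i * g' i y = _
    ring
  have e3 : ‖∑ i, lam i * ((1 - f (x i)) * (g i y - g' i y))‖ ≤ ε / 4 * (2 * ‖y‖) := by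
    calc ‖∑ i, lam i * ((1 - f (x i)) * (g i y - g' i y))‖
        ≤ ∑ i, ‖lam i * ((1 - f (x i)) * (g i y - g' i y))‖ := norm_sum_le _ _
      _ ≤ ∑ i, lam i * (ε / 4 * (2 * ‖y‖)) := by
        refine Finset.sum_le_sum fun i _ => ?_
        rw [norm_mul, norm_mul, Real.norm_of_nonneg (hlam i).le]
        have hfx1 : f (x i) ≤ 1 := by
          have := (le_abs_self _).trans (f.le_opNorm (x i))
          rw [hf, one_mul] at this
          linarith [hx i]
        have a1 : ‖1 - f (x i)‖ ≤ ε / 4 := by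
          rw [Real.norm_of_nonneg (by linarith)]; linarith [hfx i]
        have b1 := ContinuousLinearMap.le_of_opNorm_le _ (hg i).1 y
        have b2 := ContinuousLinearMap.le_of_opNorm_le _ (hg' i).1 y
        have a2 : ‖g i y - g' i y‖ ≤ 2 * ‖y‖ := by
          have := norm_sub_le (g i y) (g' i y)
          linarith
        have := (hlam i).le
        gcongr
      _ = ε / 4 * (2 * ‖y‖) := by rw [← Finset.sum_mul, hsum, one_mul]
  rw [e1] at key
  rw [e2]
  have := norm_add_le (∑ i, lam i * (f (x i) * (g i y - g' i y)))
    (∑ i, lam i * ((1 - f (x i)) * (g i y - g' i y)))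
  linarith
end

section
/- Let Y be a real Banach space. Then L(ℓ₁, Y)*, the dual of the space of bounded linear operators from ℓ₁ (real sequences with summable absolute values) to Y, has the w*-Ball Small Combination of Slices Property if and only if Y* has the w*-Ball Small Combination of Slices Property. -/
set_option synthInstance.maxHeartbeats 1000000
set_option maxHeartbeats 1000000

open Metric Set Filter

section helpers

abbrev EllOne := lp (fun _ : ℕ => ℝ) 1

/-- Convex combinations of weak-star slices of the ball are bounded. -/
lemma wcs_bounded {Z : Type*} [NormedAddCommGroup Z] [NormedSpace ℝ Z] {n : ℕ}
    (lam : Fin (n + 1) → ℝ) (z : Fin (n + 1) → Z) (α : Fin (n + 1) → ℝ) :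
    Bornology.IsBounded {φ : StrongDual ℝ Z | ∃ g : Fin (n + 1) → StrongDual ℝ Z,
      (∀ i, ‖g i‖ ≤ 1 ∧ 1 - α i < g i (z i)) ∧ φ = ∑ i, lam i • g i} := by
  refine (Metric.isBounded_closedBall (x := (0 : StrongDual ℝ Z)) (r := ∑ i, |lam i|)).subset ?_
  rintro φ ⟨g, hg, rfl⟩
  rw [mem_closedBall_zero_iff]
  refine (norm_sum_le _ _).trans (Finset.sum_le_sum fun i _ => ?_)
  rw [norm_smul, Real.norm_eq_abs]
  exact mul_le_of_le_one_right (abs_nonneg _) (hg i).1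

abbrev eVec (n : ℕ) : EllOne := lp.single 1 n (1 : ℝ)

lemma norm_eVec (n : ℕ) : ‖eVec n‖ = 1 := by
  simp [eVec, lp.norm_single]

lemma ellOne_hasSum_norm (x : EllOne) : HasSum (fun n => ‖x n‖) ‖x‖ := by
  have h := lp.hasSum_norm (p := 1) (by norm_num) x
  simpa using h

lemma ellOne_single (n : ℕ) (c : ℝ) :
    (lp.single 1 n c : EllOne) = c • eVec n := by
  rw [eVec, ← lp.single_smul]; simp

lemma exists_coord {Y : Type*} [NormedAddCommGroup Y] [NormedSpace ℝ Y]
    (T : EllOne →L[ℝ] Y) (r : ℝ) (hr : 0 ≤ r) (h : r < ‖T‖) : ∃ n, r < ‖T (eVec n)‖ := by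
  by_contra! hc
  refine absurd (ContinuousLinearMap.opNorm_le_bound T hr fun x => ?_) (not_le.mpr h)
  have h1 : HasSum (fun n => T (lp.single 1 n (x n))) (T x) :=
    (lp.hasSum_single (by norm_num) x).mapL T
  have h2 : HasSum (fun n => r * ‖x n‖) (r * ‖x‖) := (ellOne_hasSum_norm x).mul_left r
  rw [← h1.tsum_eq]
  refine tsum_of_norm_bounded h2 fun n => ?_
  rw [ellOne_single, map_smul, norm_smul, mul_comm]
  exact mul_le_mul_of_nonneg_right (hc n) (norm_nonneg _)

/-- The summation functional on `ℓ₁`. -/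
noncomputable def sumFun : StrongDual ℝ EllOne :=
  LinearMap.mkContinuous
    { toFun := fun x => ∑' n, x n
      map_add' := fun x y => by
        have hx : Summable (fun n => x n) := (ellOne_hasSum_norm x).summable.of_norm
        have hy : Summable (fun n => y n) := (ellOne_hasSum_norm y).summable.of_norm
        simpa using hx.tsum_add hy
      map_smul' := fun c x => by
        simp [tsum_mul_left] } 1 (fun x => by
        rw [one_mul]
        exact tsum_of_norm_bounded (ellOne_hasSum_norm x) fun n => le_rfl)

lemma norm_sumFun : ‖sumFun‖ ≤ 1 := LinearMap.mkContinuous_norm_le _ zero_le_one _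

lemma sumFun_eVec (n : ℕ) : sumFun (eVec n) = 1 := by
  change ∑' m, (eVec n) m = 1
  rw [tsum_eq_single n]
  · simp [eVec]
  · intro m hm
    simp [eVec, hm]

/-- The zeroth coordinate functional. -/
noncomputable def coordZero : StrongDual ℝ EllOne :=
  LinearMap.mkContinuous
    { toFun := fun x => x 0
      map_add' := fun x y => by simp
      map_smul' := fun c x => by simp } 1 (fun x => by
        rw [one_mul]
        exact lp.norm_apply_le_norm (by norm_num) x 0)

lemma coordZero_apply (x : EllOne) : coordZero x = x 0 := rfl

lemma norm_coordZero : ‖coordZero‖ ≤ 1 := LinearMap.mkContinuous_norm_le _ zero_le_one _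

lemma coordZero_eVec : coordZero (eVec 0) = 1 := by
  simp [coordZero_apply, eVec]

lemma norm_split (x : EllOne) : ‖x 0‖ + ‖x - x 0 • eVec 0‖ = ‖x‖ := by
  have h := ellOne_hasSum_norm x
  have h' := ellOne_hasSum_norm (x - x 0 • eVec 0)
  rw [← h.tsum_eq, ← h'.tsum_eq, h.summable.tsum_eq_zero_add, h'.summable.tsum_eq_zero_add]
  have e0 : (x - x 0 • eVec 0) 0 = 0 := by
    change x 0 - x 0 * (eVec 0) 0 = 0
    simp [eVec]
  have e1 : ∀ b : ℕ, (x - x 0 • eVec 0) (b + 1) = x (b + 1) := by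
    intro b
    change x (b + 1) - x 0 * (eVec 0) (b + 1) = x (b + 1)
    simp [eVec]
  simp only [e0, e1, norm_zero, zero_add]

variable {Y : Type*} [NormedAddCommGroup Y] [NormedSpace ℝ Y]

/-- `y ↦ (x ↦ f x • y)`. -/
noncomputable def embOp (f : StrongDual ℝ EllOne) : Y →L[ℝ] (EllOne →L[ℝ] Y) :=
  ContinuousLinearMap.smulRightL ℝ EllOne Y f

lemma embOp_apply (f : StrongDual ℝ EllOne) (y : Y) (x : EllOne) : embOp f y x = f x • y := rfl

lemma norm_embOp (f : StrongDual ℝ EllOne) (hf : ‖f‖ ≤ 1) : ‖embOp (Y := Y) f‖ ≤ 1 := by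
  refine ContinuousLinearMap.opNorm_le_bound _ zero_le_one fun y => ?_
  refine ContinuousLinearMap.opNorm_le_bound _ (by positivity) fun x => ?_
  rw [embOp_apply, norm_smul, one_mul, mul_comm]
  exact mul_le_mul_of_nonneg_left (f.le_of_opNorm_le hf x |>.trans (by rw [one_mul]))
    (norm_nonneg _)

/-- `T ↦ T (e_n)`. -/
noncomputable def evOp (n : ℕ) : (EllOne →L[ℝ] Y) →L[ℝ] Y := ContinuousLinearMap.apply ℝ Y (eVec n)

lemma evOp_apply (n : ℕ) (T : EllOne →L[ℝ] Y) : evOp n T = T (eVec n) := rfl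

lemma norm_evOp (n : ℕ) : ‖evOp (Y := Y) n‖ ≤ 1 := by
  refine ContinuousLinearMap.opNorm_le_bound _ zero_le_one fun T => ?_
  rw [evOp_apply, one_mul]
  simpa [norm_eVec] using T.le_opNorm (eVec n)

lemma norm_comp_le_of {A B : Type*} [NormedAddCommGroup A] [NormedSpace ℝ A]
    [NormedAddCommGroup B] [NormedSpace ℝ B] (f : StrongDual ℝ B) (L : A →L[ℝ] B)
    (hL : ‖L‖ ≤ 1) : ‖f.comp L‖ ≤ ‖f‖ :=
  (f.opNorm_comp_le L).trans (mul_le_of_le_one_right (norm_nonneg _) hL)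

lemma forward_dir (H : WStarBallSCSProperty (EllOne →L[ℝ] Y)) : WStarBallSCSProperty Y := by
  intro ε hε
  obtain ⟨n, lam, T, α, hlam, hsum, hT, hα, hd⟩ := H ε hε
  have key : ∀ i, ∃ k, 1 - α i < ‖T i (eVec k)‖ := fun i =>
    exists_coord (T i) (1 - α i) (by linarith [(hα i).2]) (by rw [hT i]; linarith [(hα i).1])
  choose k hk using key
  have hpos : ∀ i, 0 < ‖T i (eVec (k i))‖ := fun i => by linarith [hk i, (hα i).2]
  refine ⟨n, lam, fun i => ‖T i (eVec (k i))‖⁻¹ • T i (eVec (k i)),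
    fun i => 1 - (1 - α i) / ‖T i (eVec (k i))‖, hlam, hsum, ?_, ?_, ?_⟩
  · intro i
    rw [norm_smul, norm_inv, norm_norm, inv_mul_cancel₀ (hpos i).ne']
  · intro i
    have h1 : (1 - α i) / ‖T i (eVec (k i))‖ < 1 := (div_lt_one (hpos i)).mpr (hk i)
    have h2 : 0 < (1 - α i) / ‖T i (eVec (k i))‖ := div_pos (by linarith [(hα i).2]) (hpos i)
    constructor <;> linarith
  · refine lt_of_le_of_lt (Metric.diam_le_of_forall_dist_le Metric.diam_nonneg ?_) hd
    have mem : ∀ g : Fin (n + 1) → StrongDual ℝ Y, (∀ i, ‖g i‖ ≤ 1 ∧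
        1 - (1 - (1 - α i) / ‖T i (eVec (k i))‖) <
          g i (‖T i (eVec (k i))‖⁻¹ • T i (eVec (k i)))) →
        ∀ i, ‖(g i).comp (evOp (k i))‖ ≤ 1 ∧ 1 - α i < (g i).comp (evOp (k i)) (T i) := by
      intro g hg i
      refine ⟨(norm_comp_le_of _ _ (norm_evOp _)).trans (hg i).1, ?_⟩
      have := (hg i).2
      rw [map_smul, smul_eq_mul, sub_sub_cancel, div_eq_inv_mul] at this
      exact lt_of_mul_lt_mul_left this (inv_nonneg.mpr (hpos i).le)
    have back : ∀ g : Fin (n + 1) → StrongDual ℝ Y,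
        (∑ i, lam i • g i) = (∑ i, lam i • (g i).comp (evOp (k i))).comp (embOp sumFun) := by
      intro g
      ext y
      simp [evOp_apply, embOp_apply, sumFun_eVec]
    rintro φ ⟨g, hg, rfl⟩ ψ ⟨g', hg', rfl⟩
    rw [back g, back g', dist_eq_norm, ← ContinuousLinearMap.sub_comp]
    refine (norm_comp_le_of _ _ (norm_embOp _ norm_sumFun)).trans ?_
    rw [← dist_eq_norm]
    exact Metric.dist_le_diam_of_mem (wcs_bounded lam T α) ⟨_, mem g hg, rfl⟩ ⟨_, mem g' hg', rfl⟩

lemma remainder_bound (y : Y) (hy : ‖y‖ = 1) (β : ℝ) (h : StrongDual ℝ (EllOne →L[ℝ] Y))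
    (hn : ‖h‖ ≤ 1) (hs : 1 - β < h (embOp coordZero y)) (hβ : 0 < β) :
    ‖h - (h.comp (embOp coordZero)).comp (evOp 0)‖ ≤ β := by
  have aux : ∀ S : EllOne →L[ℝ] Y, ‖S‖ ≤ 1 →
      (h - (h.comp (embOp coordZero)).comp (evOp 0)) S ≤ β := by
    intro S hS
    have h1 : ‖embOp coordZero y + (S - embOp coordZero (evOp 0 S))‖ ≤ 1 := by
      refine ContinuousLinearMap.opNorm_le_bound _ zero_le_one fun x => ?_
      have e : (embOp coordZero y + (S - embOp coordZero (evOp 0 S))) x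
          = x 0 • y + S (x - x 0 • eVec 0) := by
        simp [embOp_apply, evOp_apply, coordZero_apply]
      rw [e, one_mul, ← norm_split x]
      refine (norm_add_le _ _).trans (add_le_add ?_ ?_)
      · rw [norm_smul, hy, mul_one]
      · simpa using S.le_of_opNorm_le hS (x - x 0 • eVec 0)
    have h2 := h.le_of_opNorm_le hn (embOp coordZero y + (S - embOp coordZero (evOp 0 S)))
    have h3 := le_abs_self (h (embOp coordZero y + (S - embOp coordZero (evOp 0 S))))
    rw [Real.norm_eq_abs] at h2
    rw [map_add, map_sub] at h2 h3
    simp only [sub_apply, ContinuousLinearMap.comp_apply]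
    linarith
  refine ContinuousLinearMap.opNorm_le_of_unit_norm hβ.le fun S hS => ?_
  rw [Real.norm_eq_abs, abs_le]
  have h1 := aux S hS.le
  have h2 := aux (-S) (by rw [norm_neg, hS])
  rw [map_neg] at h2
  constructor <;> linarith

lemma norm_embOp_coordZero (y : Y) (hy : ‖y‖ = 1) :
    ‖(embOp coordZero y : EllOne →L[ℝ] Y)‖ = 1 := by
  apply le_antisymm
  · have h := (embOp (Y := Y) coordZero).le_of_opNorm_le (norm_embOp _ norm_coordZero) y
    rwa [hy, one_mul] at h
  · have h := (embOp coordZero y).le_opNorm (eVec 0)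
    rwa [embOp_apply, coordZero_eVec, one_smul, norm_eVec, mul_one, hy] at h

lemma backward_abs {W : Type*} [NormedAddCommGroup W] [NormedSpace ℝ W]
    (E : Y →L[ℝ] W) (V : W →L[ℝ] Y) (hE : ‖E‖ ≤ 1) (hV : ‖V‖ ≤ 1)
    (hN : ∀ y : Y, ‖y‖ = 1 → ‖E y‖ = 1)
    (hR : ∀ (y : Y), ‖y‖ = 1 → ∀ (β : ℝ) (h : StrongDual ℝ W), ‖h‖ ≤ 1 → 1 - β < h (E y) →
      0 < β → ‖h - (h.comp E).comp V‖ ≤ β)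
    (H : WStarBallSCSProperty Y) : WStarBallSCSProperty W := by
  intro ε hε
  obtain ⟨n, lam, y, α, hlam, hsum, hy, hα, hd⟩ := H (ε / 2) (by positivity)
  have hβ : ∀ i, 0 < min (α i) (ε / 8) := fun i => lt_min (hα i).1 (by positivity)
  refine ⟨n, lam, fun i => E (y i), fun i => min (α i) (ε / 8), hlam, hsum, ?_, ?_, ?_⟩
  · exact fun i => hN (y i) (hy i)
  · exact fun i => ⟨hβ i, (min_le_left _ _).trans_lt (hα i).2⟩
  · refine lt_of_le_of_lt (Metric.diam_le_of_forall_dist_le (C := ε / 2 + ε / 8 + ε / 8)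
      (by positivity) ?_) (by linarith)
    have mem : ∀ h : Fin (n + 1) → StrongDual ℝ (W), (∀ i, ‖h i‖ ≤ 1 ∧
        1 - min (α i) (ε / 8) < h i (E (y i))) →
        ∀ i, ‖(h i).comp E‖ ≤ 1 ∧
          1 - α i < (h i).comp E (y i) := by
      intro h hh i
      refine ⟨(norm_comp_le_of _ _ hE).trans (hh i).1, ?_⟩
      have := (hh i).2
      have := min_le_left (α i) (ε / 8)
      rw [ContinuousLinearMap.comp_apply]
      linarith
    have close : ∀ h : Fin (n + 1) → StrongDual ℝ (W), (∀ i, ‖h i‖ ≤ 1 ∧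
        1 - min (α i) (ε / 8) < h i (E (y i))) →
        ‖(∑ i, lam i • h i) -
          (∑ i, lam i • (h i).comp E).comp V‖ ≤ ε / 8 := by
      intro h hh
      have e : (∑ i, lam i • h i) - (∑ i, lam i • (h i).comp E).comp V
          = ∑ i, lam i • (h i - ((h i).comp E).comp V) := by
        ext S
        simp [mul_sub, Finset.sum_sub_distrib]
      rw [e]
      calc _ ≤ ∑ i, lam i * (ε / 8) := by
            refine (norm_sum_le _ _).trans (Finset.sum_le_sum fun i _ => ?_)
            rw [norm_smul, Real.norm_eq_abs, abs_of_pos (hlam i)]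
            exact mul_le_mul_of_nonneg_left
              ((hR (y i) (hy i) _ (h i) (hh i).1 (hh i).2 (hβ i)).trans
                (min_le_right _ _)) (hlam i).le
        _ = ε / 8 := by rw [← Finset.sum_mul, hsum, one_mul]
    rintro φ ⟨g, hg, rfl⟩ ψ ⟨g', hg', rfl⟩
    have c1 := close g hg
    have c2 := close g' hg'
    have c3 : dist ((∑ i, lam i • (g i).comp E).comp V)
        ((∑ i, lam i • (g' i).comp E).comp V) ≤ ε / 2 := by
      rw [dist_eq_norm, ← ContinuousLinearMap.sub_comp]
      refine (norm_comp_le_of _ _ hV).trans ?_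
      rw [← dist_eq_norm]
      exact (Metric.dist_le_diam_of_mem (wcs_bounded lam y α) ⟨_, mem g hg, rfl⟩
        ⟨_, mem g' hg', rfl⟩).trans hd.le
    rw [← dist_eq_norm] at c1 c2
    rw [dist_comm] at c2
    have := dist_triangle4 (∑ i, lam i • g i)
      ((∑ i, lam i • (g i).comp E).comp V)
      ((∑ i, lam i • (g' i).comp E).comp V) (∑ i, lam i • g' i)
    linarith

lemma backward_dir (H : WStarBallSCSProperty Y) : WStarBallSCSProperty (EllOne →L[ℝ] Y) :=
  backward_abs (embOp coordZero) (evOp 0) (norm_embOp _ norm_coordZero) (norm_evOp _)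
    norm_embOp_coordZero remainder_bound H

end helpers

/-- Corollary 2.19: `L(ℓ₁, Y)*` has the `w*`-BSCSP iff `Y*` has the
`w*`-BSCSP. -/
theorem statement14 {Y : Type*} [NormedAddCommGroup Y] [NormedSpace ℝ Y] [CompleteSpace Y] :
    WStarBallSCSProperty (lp (fun _ : ℕ => ℝ) 1 →L[ℝ] Y) ↔ WStarBallSCSProperty Y := by
  exact ⟨forward_dir, backward_dir⟩
end
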